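/- The game-theoretic upper expectation E_V is not continuous with respect to downward pointwise convergence: in the vacuous imprecise probability tree on X = {0,1}, the events A_n := {ω : ω_i = 1 for all 1 ≤ i ≤ n} \ {(1,1,1,...)} satisfy that the indicator gambles 1_{A_n} decrease pointwise to 0, yet E_V(1_{A_n}) = 1 for all n while E_V(0) = 0. -/

import Mathlib

open Filter

/-- prefix of length `n` of a path -/
def pref {X : Type*} (ω : ℕ → X) (n : ℕ) : List X := (List.range n).map ω

/-- process difference -/
def pdiff {X : Type*} (M : List X → ℝ) (s : List X) : X → ℝ := fun x => M (s ++ [x]) - M s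

/-- process multiplier -/
noncomputable def pmul {X : Type*} (M : List X → ℝ) (s : List X) : X → ℝ :=
  fun x => M (s ++ [x]) / M s

/-- family of coherent upper expectations (local models of an imprecise probability tree) -/
def Coherent {X : Type*} (Q : List X → (X → ℝ) → ℝ) : Prop :=
  ∀ s : List X,
    (∀ h : X → ℝ, Q s h ≤ ⨆ x, h x) ∧
    (∀ h g : X → ℝ, Q s (h + g) ≤ Q s h + Q s g) ∧
    (∀ (h : X → ℝ) (c : ℝ), 0 ≤ c → Q s (c • h) = c * Q s h)

/-- supermartingale for the tree with local models `Q` -/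
def IsSupermart {X : Type*} (Q : List X → (X → ℝ) → ℝ) (M : List X → ℝ) : Prop :=
  ∀ s : List X, Q s (pdiff M s) ≤ 0

/-- bounded below process -/
def BddBelowProc {X : Type*} (M : List X → ℝ) : Prop := ∃ C : ℝ, ∀ s : List X, C ≤ M s

/-- test supermartingale: nonnegative supermartingale with initial value 1 -/
def IsTestSupermart {X : Type*} (Q : List X → (X → ℝ) → ℝ) (M : List X → ℝ) : Prop :=
  IsSupermart Q M ∧ (∀ s : List X, 0 ≤ M s) ∧ M [] = 1

/-- game-theoretic upper expectation conditional on a situation `s` -/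
noncomputable def EV {X : Type*} (Q : List X → (X → ℝ) → ℝ) (f : (ℕ → X) → EReal)
    (s : List X) : EReal :=
  sInf { y : EReal | ∃ M : List X → ℝ, IsSupermart Q M ∧ BddBelowProc M ∧
    (∀ ω : ℕ → X, pref ω s.length = s →
      f ω ≤ Filter.liminf (fun n => ((M (pref ω n) : ℝ) : EReal)) Filter.atTop) ∧
    y = ((M s : ℝ) : EReal) }

theorem EV_vacuous_eq
    (Q : List Bool → (Bool → ℝ) → ℝ) (hQ : ∀ (s : List Bool) (h : Bool → ℝ), Q s h = ⨆ x, h x)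
    (f : (ℕ → Bool) → EReal) (c : ℝ) (hle : ∀ ω, f ω ≤ (c : EReal))
    (ω₀ : ℕ → Bool) (h0 : f ω₀ = (c : EReal)) : EV Q f [] = (c : EReal) := by
  apply le_antisymm
  · apply sInf_le
    refine ⟨fun _ => c, ?_, ⟨c, fun _ => le_rfl⟩, ?_, rfl⟩
    · intro s
      rw [hQ]
      simp [pdiff]
    · intro ω _
      simpa using hle ω
  · apply le_sInf
    rintro y ⟨M, hM, -, hf, rfl⟩
    have hstep : ∀ (s : List Bool) (x : Bool), M (s ++ [x]) ≤ M s := by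
      intro s x
      have h1 := hM s
      rw [hQ] at h1
      have h2 : pdiff M s x ≤ ⨆ x, pdiff M s x :=
        le_ciSup (Set.finite_range (pdiff M s)).bddAbove x
      have h3 : pdiff M s x = M (s ++ [x]) - M s := rfl
      linarith
    have hn : ∀ n, M (pref ω₀ n) ≤ M [] := by
      intro n
      induction n with
      | zero => simp [pref]
      | succ k ih =>
        have h4 : pref ω₀ (k + 1) = pref ω₀ k ++ [ω₀ k] := by
          simp [pref, List.range_succ]
        rw [h4]
        exact (hstep _ _).trans ih
    have h5 := hf ω₀ (by simp [pref])
    rw [h0] at h5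
    refine h5.trans ?_
    calc Filter.liminf (fun n => ((M (pref ω₀ n) : ℝ) : EReal)) Filter.atTop
        ≤ Filter.liminf (fun _ : ℕ => ((M [] : ℝ) : EReal)) Filter.atTop := by
          exact Filter.liminf_le_liminf
            (Filter.Eventually.of_forall fun n => EReal.coe_le_coe_iff.2 (hn n))
      _ = _ := by simp

theorem EV_not_downward_continuous
    (Q : List Bool → (Bool → ℝ) → ℝ) (hQ : ∀ (s : List Bool) (h : Bool → ℝ), Q s h = ⨆ x, h x)
    (A : ℕ → Set (ℕ → Bool))
    (hA : ∀ n, A n = {ω : ℕ → Bool | (∀ i < n, ω i = true) ∧ ω ≠ fun _ => true})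
    (ind : ℕ → (ℕ → Bool) → EReal)
    (hind : ∀ n ω, (ω ∈ A n → ind n ω = 1) ∧ (ω ∉ A n → ind n ω = 0)) :
    (∀ ω, Antitone (fun n => ind n ω)) ∧
    (∀ ω, Filter.Tendsto (fun n => ind n ω) Filter.atTop (nhds 0)) ∧
    (∀ n, EV Q (ind n) [] = 1) ∧
    EV Q (fun _ => (0 : EReal)) [] = 0 := by
  have hle1 : ∀ n ω, ind n ω ≤ 1 := by
    intro n ω
    by_cases h : ω ∈ A n
    · rw [(hind n ω).1 h]
    · rw [(hind n ω).2 h]; exact zero_le_one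
  refine ⟨?_, ?_, ?_, ?_⟩
  · intro ω m n hmn
    show ind n ω ≤ ind m ω
    by_cases h : ω ∈ A m
    · rw [(hind m ω).1 h]; exact hle1 n ω
    · have h' : ω ∉ A n := by
        intro hn
        apply h
        rw [hA] at hn ⊢
        exact ⟨fun i hi => hn.1 i (lt_of_lt_of_le hi hmn), hn.2⟩
      rw [(hind m ω).2 h, (hind n ω).2 h']
  · intro ω
    have hev : ∃ N, ∀ n ≥ N, ω ∉ A n := by
      by_cases h : ω = fun _ => true
      · refine ⟨0, fun n _ hn => ?_⟩
        rw [hA] at hn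
        exact hn.2 h
      · obtain ⟨i, hi⟩ := Function.ne_iff.1 h
        refine ⟨i + 1, fun n hn' hn => ?_⟩
        rw [hA] at hn
        exact hi (hn.1 i (by omega))
    obtain ⟨N, hN⟩ := hev
    apply tendsto_const_nhds.congr'
    filter_upwards [Filter.eventually_ge_atTop N] with n hn
    exact ((hind n ω).2 (hN n hn)).symm
  · intro n
    have hmem : (fun i => decide (i < n)) ∈ A n := by
      rw [hA]
      refine ⟨fun i hi => by simpa using hi, fun h => ?_⟩
      have := congrFun h n
      simp at this
    have := EV_vacuous_eq Q hQ (ind n) 1 (by simpa using hle1 n) (fun i => decide (i < n))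
      (by rw [(hind n _).1 hmem]; simp)
    simpa using this
  · have := EV_vacuous_eq Q hQ (fun _ => 0) 0 (by simp) (fun _ => true) (by simp)
    simpa using this
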